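/- Let $I=[t_0,t_0+r]$ and let $f:I\times\mathbb{R}\to\mathbb{R}$ be continuous with $|f(t,y_1)-f(t,y_2)|\le L|y_1-y_2|$ for all $t\in I$, $y_1,y_2\in\mathbb{R}$, $L>0$. Let $\varepsilon>0$ and suppose a continuous $y:I\to\mathbb{R}$ satisfies $|y(t)-\int_{t_0}^{t} f(s,y(s))\,ds|\le\varepsilon$ for all $t\in I$. Then for every $\eta>L$ there exists a unique continuous solution $y_0$ of $y_0(t)=\int_{t_0}^{t} f(s,y_0(s))\,ds$ with $|y(t)-y_0(t)|\le \frac{\varepsilon\, e^{\eta r}}{1-L/\eta}$ for all $t\in I$. -/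

import Mathlib

open Real Set in
lemma exp_neg_mul_integral_exp_le {a t η : ℝ} (hη : 0 < η) :
    exp (-(η * (t - a))) * ∫ s in a..t, exp (η * (s - a)) ≤ 1 / η := by
  have hderiv : ∀ s ∈ uIcc a t,
      HasDerivAt (fun s => exp (η * (s - a)) / η) (exp (η * (s - a))) s := fun s _ => by
    have h := ((((hasDerivAt_id s).sub_const a).const_mul η).exp).div_const η
    simpa [hη.ne'] using h
  rw [intervalIntegral.integral_eq_sub_of_hasDerivAt hderiv
    (Continuous.intervalIntegrable (by fun_prop) _ _), exp_neg]
  have hpos := exp_pos (η * (t - a))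
  rw [inv_mul_le_iff₀ hpos, sub_self, mul_zero, exp_zero]
  have : 0 < 1 / η := by positivity
  calc exp (η * (t - a)) / η - 1 / η ≤ exp (η * (t - a)) / η := by linarith
    _ = exp (η * (t - a)) * (1 / η) := by ring

open Real Set in
/-- The Picard operator `u ↦ ∫_a^t F(s, u(s)) ds` conjugated by the Bielecki weight
`exp (-η (t - a))`. -/
noncomputable def weightedPicard {a b : ℝ} (hab : a ≤ b) (η : ℝ) (F : ℝ → ℝ → ℝ)
    (hF : Continuous fun p : ℝ × ℝ => F p.1 p.2) (v : C(Icc a b, ℝ)) : C(Icc a b, ℝ) where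
  toFun t := exp (-(η * (t - a))) * ∫ s in a..t, F s (exp (η * (s - a)) * IccExtend hab v s)
  continuous_toFun := by
    have hv : Continuous (IccExtend hab v) := v.continuous.Icc_extend'
    have hint : Continuous fun s => F s (exp (η * (s - a)) * IccExtend hab v s) :=
      hF.comp (by fun_prop : Continuous fun s => (s, exp (η * (s - a)) * IccExtend hab v s))
    have hprim := intervalIntegral.continuous_primitive
      (fun c d => hint.intervalIntegrable (μ := MeasureTheory.volume) c d) a
    exact (by fun_prop : Continuous fun t : Icc a b => exp (-(η * (t - a)))).mul
      (hprim.comp continuous_subtype_val)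

open Real Set in
lemma contractingWith_weightedPicard {a b : ℝ} (hab : a ≤ b) {L η : ℝ} (hL : 0 ≤ L) (hη : L < η)
    {F : ℝ → ℝ → ℝ} (hF : Continuous fun p : ℝ × ℝ => F p.1 p.2)
    (hlip : ∀ t y₁ y₂, |F t y₁ - F t y₂| ≤ L * |y₁ - y₂|) :
    ContractingWith (L / η).toNNReal (weightedPicard hab η F hF) := by
  have hη0 : 0 < η := hL.trans_lt hη
  refine ⟨by simpa [div_lt_one hη0] using hη, LipschitzWith.of_dist_le_mul fun v w => ?_⟩
  rw [Real.coe_toNNReal _ (by positivity), ContinuousMap.dist_le (by positivity)]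
  intro t
  have hcont (u : C(Icc a b, ℝ)) :
      Continuous fun s => F s (exp (η * (s - a)) * IccExtend hab u s) := by
    have hu : Continuous (IccExtend hab u) := u.continuous.Icc_extend'
    exact hF.comp (by fun_prop : Continuous fun s => (s, exp (η * (s - a)) * IccExtend hab u s))
  have hint (u : C(Icc a b, ℝ)) := (hcont u).intervalIntegrable (μ := MeasureTheory.volume) a t
  have hbound : ‖∫ s in a..t, (F s (exp (η * (s - a)) * IccExtend hab v s) -
      F s (exp (η * (s - a)) * IccExtend hab w s))‖ ≤
      ∫ s in a..t, L * dist v w * exp (η * (s - a)) := by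
    refine intervalIntegral.norm_integral_le_of_norm_le t.2.1 (.of_forall fun s _ => ?_)
      (Continuous.intervalIntegrable (by fun_prop) _ _)
    refine (hlip s _ _).trans ?_
    rw [← mul_sub, abs_mul, abs_of_pos (exp_pos _), mul_assoc, mul_comm (dist v w)]
    gcongr
    exact ContinuousMap.dist_apply_le_dist (f := v) (g := w) (projIcc a b hab s)
  rw [intervalIntegral.integral_sub (hint v) (hint w), intervalIntegral.integral_const_mul]
    at hbound
  simp only [weightedPicard, ContinuousMap.coe_mk, Real.dist_eq]
  rw [← mul_sub, abs_mul, abs_of_pos (exp_pos _)]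
  calc _ ≤ exp (-(η * (t - a))) * (L * dist v w * ∫ s in a..t, exp (η * (s - a))) := by
        gcongr
        exact hbound
    _ = L * dist v w * (exp (-(η * (t - a))) * ∫ s in a..t, exp (η * (s - a))) := by ring
    _ ≤ L * dist v w * (1 / η) := by
        gcongr
        exact exp_neg_mul_integral_exp_le hη0
    _ = L / η * dist v w := by ring

open Real Set in
/-- A function `u` on `[a, b]`, multiplied by the Bielecki weight `exp (-η (t - a))`. -/
noncomputable def weighted {a b : ℝ} (η : ℝ) (u : ℝ → ℝ) (hu : ContinuousOn u (Icc a b)) :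
    C(Icc a b, ℝ) where
  toFun t := exp (-(η * (t - a))) * u t
  continuous_toFun := by
    have := hu.domRestrict
    exact (by fun_prop : Continuous fun t : Icc a b => exp (-(η * (t - a)))).mul this

open Real Set in
lemma weightedPicard_weighted_apply {a b : ℝ} (hab : a ≤ b) (η : ℝ) {F : ℝ → ℝ → ℝ}
    (hF : Continuous fun p : ℝ × ℝ => F p.1 p.2) {u : ℝ → ℝ} (hu : ContinuousOn u (Icc a b))
    (t : Icc a b) :
    weightedPicard hab η F hF (weighted η u hu) t =
      exp (-(η * (t - a))) * ∫ s in a..t, F s (u s) := by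
  simp only [weightedPicard, ContinuousMap.coe_mk]
  congr 1
  refine intervalIntegral.integral_congr fun s hs => ?_
  rw [uIcc_of_le t.2.1] at hs
  have hs' : s ∈ Icc a b := ⟨hs.1, hs.2.trans t.2.2⟩
  simp [IccExtend_of_mem hab _ hs', weighted, ← mul_assoc, ← exp_add]

/-- Hyers–Ulam stability of `y(t) = ∫_{t₀}^t f(s, y(s)) ds` on `[t₀, t₀+r]`,
valid for every Lipschitz constant `L > 0` (no smallness condition `Lr < 1`):
an `ε`-approximate solution is within `ε e^{ηr}/(1 - L/η)` of a unique exact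
continuous solution, for any fixed `η > L`. -/
theorem volterra_HU_stability
    (t₀ r L η ε : ℝ) (hr : 0 < r) (hL : 0 < L) (hη : L < η) (hε : 0 < ε)
    (f : ℝ → ℝ → ℝ)
    (hf : ContinuousOn (fun p : ℝ × ℝ => f p.1 p.2) (Set.Icc t₀ (t₀ + r) ×ˢ Set.univ))
    (hlip : ∀ t ∈ Set.Icc t₀ (t₀ + r), ∀ y₁ y₂ : ℝ,
      |f t y₁ - f t y₂| ≤ L * |y₁ - y₂|)
    (y : ℝ → ℝ) (hy : ContinuousOn y (Set.Icc t₀ (t₀ + r)))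
    (happrox : ∀ t ∈ Set.Icc t₀ (t₀ + r),
      |y t - ∫ s in t₀..t, f s (y s)| ≤ ε) :
    ∃ y₀ : ℝ → ℝ,
      (ContinuousOn y₀ (Set.Icc t₀ (t₀ + r)) ∧
        (∀ t ∈ Set.Icc t₀ (t₀ + r), y₀ t = ∫ s in t₀..t, f s (y₀ s)) ∧
        (∀ t ∈ Set.Icc t₀ (t₀ + r),
          |y t - y₀ t| ≤ ε * Real.exp (η * r) / (1 - L / η))) ∧
      (∀ z : ℝ → ℝ,
        ContinuousOn z (Set.Icc t₀ (t₀ + r)) →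
        (∀ t ∈ Set.Icc t₀ (t₀ + r), z t = ∫ s in t₀..t, f s (z s)) →
        (∀ t ∈ Set.Icc t₀ (t₀ + r),
          |y t - z t| ≤ ε * Real.exp (η * r) / (1 - L / η)) →
        ∀ t ∈ Set.Icc t₀ (t₀ + r), z t = y₀ t) := by
  have hab : t₀ ≤ t₀ + r := by linarith
  have hη0 : 0 < η := hL.trans hη
  set F : ℝ → ℝ → ℝ := fun t x => f (Set.projIcc t₀ (t₀ + r) hab t) x with hFdef
  have hF : Continuous fun p : ℝ × ℝ => F p.1 p.2 :=
    hf.comp_continuous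
      (by fun_prop : Continuous fun p : ℝ × ℝ =>
        ((Set.projIcc t₀ (t₀ + r) hab p.1 : ℝ), p.2))
      fun p => ⟨(Set.projIcc t₀ (t₀ + r) hab p.1).2, Set.mem_univ _⟩
  have hFint (u : ℝ → ℝ) {t : ℝ} (ht : t ∈ Set.Icc t₀ (t₀ + r)) :
      ∫ s in t₀..t, F s (u s) = ∫ s in t₀..t, f s (u s) := by
    refine intervalIntegral.integral_congr fun s hs => ?_
    rw [Set.uIcc_of_le ht.1] at hs
    simp only [hFdef, Set.projIcc_of_mem hab ⟨hs.1, hs.2.trans ht.2⟩]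
  have hcontr := contractingWith_weightedPicard hab hL.le hη hF
    fun t => hlip _ (Set.projIcc t₀ (t₀ + r) hab t).2
  set T := weightedPicard hab η F hF
  set v := ContractingWith.fixedPoint T hcontr
  have hv : T v = v := hcontr.fixedPoint_isFixedPt
  have hexp (t : ℝ) : Real.exp (η * (t - t₀)) * Real.exp (-(η * (t - t₀))) = 1 := by
    rw [← Real.exp_add, add_neg_cancel, Real.exp_zero]
  refine ⟨fun t => Real.exp (η * (t - t₀)) * Set.IccExtend hab v t, ⟨?_, ?_, ?_⟩, ?_⟩
  · have hvc : Continuous (Set.IccExtend hab v) := v.continuous.Icc_extend'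
    exact Continuous.continuousOn (by fun_prop)
  · intro t ht
    have h := congrArg (fun w : C(Set.Icc t₀ (t₀ + r), ℝ) => w ⟨t, ht⟩) hv
    simp only [T, weightedPicard, ContinuousMap.coe_mk] at h
    beta_reduce
    rw [← hFint _ ht, Set.IccExtend_of_mem hab _ ht, ← h, ← mul_assoc, hexp, one_mul]
  · intro t ht
    have hstep : dist (weighted η y hy) (T (weighted η y hy)) ≤ ε := by
      rw [ContinuousMap.dist_le hε.le]
      intro s
      rw [weightedPicard_weighted_apply hab η hF hy, hFint y s.2, Real.dist_eq]
      simp only [weighted, ContinuousMap.coe_mk]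
      rw [← mul_sub, abs_mul, abs_of_pos (Real.exp_pos _), ← one_mul ε]
      have := mul_nonneg hη0.le (sub_nonneg.2 s.2.1)
      exact mul_le_mul (Real.exp_le_one_iff.2 (by linarith)) (happrox s s.2) (abs_nonneg _)
        zero_le_one
    have hpos : 0 < 1 - L / η := by
      rw [sub_pos, div_lt_one hη0]
      exact hη
    have hdist : dist (weighted η y hy) v ≤ ε / (1 - L / η) := by
      have h := hcontr.dist_fixedPoint_le (weighted η y hy)
      rw [Real.coe_toNNReal _ (by positivity)] at h
      exact h.trans (by gcongr)
    have hpt := (ContinuousMap.dist_apply_le_dist (f := weighted η y hy) (g := v) ⟨t, ht⟩).trans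
      hdist
    simp only [weighted, ContinuousMap.coe_mk, Real.dist_eq] at hpt
    beta_reduce
    rw [Set.IccExtend_of_mem hab _ ht]
    calc |y t - Real.exp (η * (t - t₀)) * v ⟨t, ht⟩|
        = |Real.exp (η * (t - t₀)) * (Real.exp (-(η * (t - t₀))) * y t - v ⟨t, ht⟩)| := by
          rw [mul_sub (Real.exp _), ← mul_assoc, hexp, one_mul]
      _ = Real.exp (η * (t - t₀)) * |Real.exp (-(η * (t - t₀))) * y t - v ⟨t, ht⟩| := by
          rw [abs_mul, abs_of_pos (Real.exp_pos _)]
      _ ≤ Real.exp (η * r) * (ε / (1 - L / η)) := by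
          gcongr
          linarith [ht.2]
      _ = ε * Real.exp (η * r) / (1 - L / η) := by ring
  · intro z hz hzeq _ t ht
    have hfix : T (weighted η z hz) = weighted η z hz := by
      ext s
      rw [weightedPicard_weighted_apply hab η hF hz, hFint z s.2, ← hzeq s s.2]
      rfl
    have hzv : weighted η z hz = v := hcontr.fixedPoint_unique hfix
    simp only [Set.IccExtend_of_mem hab _ ht, ← hzv, weighted, ContinuousMap.coe_mk]
    rw [← mul_assoc, hexp, one_mul]
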